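/- For ρ > 2 there is a constant C such that for all f₁, f₂ ∈ L¹(ℝ) and all λ > 0, λ · |{x ∈ ℝ : V_ρ(Q(f₁,f₂))(x) > λ}|² ≤ C ‖f₁‖_{L¹(ℝ)} ‖f₂‖_{L¹(ℝ)}; that is, the variation operator of the bilinear averages over cubes maps L¹ × L¹ to weak L^{1/2}. -/

import Mathlib

open MeasureTheory Set ENNReal NNReal

/-- The ρ-variation norm of a family `a : ι → E` sampled along finite increasing
systems of indices lying in `S`. -/
noncomputable def varNorm {ι E : Type*} [Preorder ι] [SeminormedAddGroup E]
    (ρ : ℝ) (S : Set ι) (a : ι → E) : ℝ≥0∞ :=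
  ⨆ (n : ℕ) (t : Fin (n + 1) → ι) (_ : StrictMono t) (_ : ∀ i, t i ∈ S),
    (∑ i : Fin n, (‖a (t i.succ) - a (t i.castSucc)‖₊ : ℝ≥0∞) ^ ρ) ^ (1 / ρ)

/-- The bilinear average over the cube of side `t` centered at `(x,x)`. -/
noncomputable def Qbil (f g : ℝ → ℂ) (t x : ℝ) : ℂ :=
  ((t : ℂ) ^ 2)⁻¹ *
    ∫ y in Set.Icc (-(t / 2)) (t / 2), ∫ z in Set.Icc (-(t / 2)) (t / 2),
      f (x - y) * g (x - z)

/-- Optimal profits `(out, in)` when trading one unit along the times in a list, starting without,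
respectively with, the unit in hand: at time `j` one may sell at price `p j` or buy at price `c j`;
a unit still held at the end is worth `z`. -/
noncomputable def tradeVal (p c : ℕ → ℝ) (z : ℝ) : List ℕ → ℝ × ℝ
  | [] => (0, z)
  | j :: l => (max (tradeVal p c z l).1 ((tradeVal p c z l).2 - c j),
      max (tradeVal p c z l).2 ((tradeVal p c z l).1 + p j))

/-- Numbers of passages of a list to a value `≥ b` after a value `≤ a`; the second component
counts as if the list were preceded by a value `≤ a`. -/
noncomputable def crossings (a b : ℝ) : List ℝ → ℕ × ℕ
  | [] => (0, 0)
  | v :: l => (if v ≤ a then (crossings a b l).2 else (crossings a b l).1,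
      if b ≤ v then (crossings a b l).1 + 1 else (crossings a b l).2)

lemma tradeVal_shift (p c : ℕ → ℝ) (z d : ℝ) (l : List ℕ) :
    tradeVal (fun j => p j + d) (fun j => c j + d) (z + d) l =
      ((tradeVal p c z l).1, (tradeVal p c z l).2 + d) := by
  induction l with
  | nil => rfl
  | cons j l ih =>
    simp only [tradeVal, ih, Prod.mk.injEq]
    constructor
    · congr 1; ring
    · rw [← max_add_add_right]; congr 1; ring

lemma tradeVal_congr {p c p' c' : ℕ → ℝ} {z : ℝ} {l : List ℕ} (hp : ∀ j ∈ l, p j = p' j)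
    (hc : ∀ j ∈ l, c j = c' j) : tradeVal p c z l = tradeVal p' c' z l := by
  induction l with
  | nil => rfl
  | cons j l ih =>
    simp only [List.mem_cons, forall_eq_or_imp] at hp hc
    simp only [tradeVal, ih hp.2 hc.2, hp.1, hc.1]

lemma crossings_fst_le_snd (a b : ℝ) (l : List ℝ) :
    (crossings a b l).1 ≤ (crossings a b l).2 ∧ (crossings a b l).2 ≤ (crossings a b l).1 + 1 := by
  induction l with
  | nil => simp [crossings]
  | cons v l ih =>
    simp only [crossings]
    split_ifs <;> omega

lemma tradeVal_add_crossings_le {a b e z : ℝ} (hab : a < b) (he : 0 ≤ e) (hz : z ≤ 0)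
    (p c v : ℕ → ℝ) (l : List ℕ)
    (h : ∀ j ∈ l, (v j ≤ a ↔ c j ≤ 0) ∧ (b ≤ v j ↔ 0 ≤ p j)) :
    (tradeVal p c z l).1 + e * (crossings a b (l.map v)).1 ≤
        (tradeVal (fun j => p j + e) c z l).1 ∧
    (tradeVal p c z l).2 + e * (crossings a b (l.map v)).2 ≤
        (tradeVal (fun j => p j + e) c z l).2 ∧
    ((crossings a b (l.map v)).2 = (crossings a b (l.map v)).1 →
      (tradeVal p c z l).2 + e * (crossings a b (l.map v)).1 ≤
        (tradeVal (fun j => p j + e) c z l).1) ∧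
    ((crossings a b (l.map v)).2 = (crossings a b (l.map v)).1 + 1 →
      (tradeVal p c z l).1 + e * (crossings a b (l.map v)).2 ≤
        (tradeVal (fun j => p j + e) c z l).2) := by
  induction l with
  | nil => simp [tradeVal, crossings, hz]
  | cons j l ih =>
    simp only [List.mem_cons, forall_eq_or_imp] at h
    obtain ⟨⟨hc, hp⟩, hl⟩ := h
    obtain ⟨h1, h2, h3, h4⟩ := ih hl
    obtain ⟨k1, k2⟩ := crossings_fst_le_snd a b (l.map v)
    simp only [List.map_cons, crossings, tradeVal]
    generalize (crossings a b (l.map v)).1 = m at *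
    generalize (crossings a b (l.map v)).2 = n at *
    generalize (tradeVal p c z l).1 = o at *
    generalize (tradeVal p c z l).2 = i at *
    generalize (tradeVal (fun j => p j + e) c z l).1 = o' at *
    generalize (tradeVal (fun j => p j + e) c z l).2 = i' at *
    have hn : n = m ∨ n = m + 1 := by omega
    have o1 := le_max_left o' (i' - c j)
    have o2 := le_max_right o' (i' - c j)
    have i1 := le_max_left i' (o' + (p j + e))
    have i2 := le_max_right i' (o' + (p j + e))
    generalize max o' (i' - c j) = oMax at *
    generalize max i' (o' + (p j + e)) = iMax at *
    have key : ∀ {x y w t : ℝ}, x + w ≤ t → y + w ≤ t → max x y + w ≤ t := by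
      intro x y w t hx hy
      rcases max_choice x y with h | h <;> rwa [h]
    by_cases ha : v j ≤ a
    · have hb : ¬ b ≤ v j := by linarith
      have hc' := hc.1 ha
      have hp' : p j < 0 := by rw [hp] at hb; linarith
      simp only [ha, hb, if_true, if_false]
      rcases hn with rfl | rfl
      · have h3 := h3 rfl
        refine ⟨key ?_ ?_, key ?_ ?_, fun _ => key ?_ ?_, fun h => by omega⟩ <;> linarith
      · have h4 := h4 rfl
        push_cast at *
        refine ⟨key ?_ ?_, key ?_ ?_, fun _ => key ?_ ?_, fun h => by omega⟩ <;> linarith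
    · have hc' : 0 < c j := by rw [hc] at ha; linarith
      by_cases hb : b ≤ v j
      · have hp' := hp.1 hb
        simp only [ha, hb, if_true, if_false]
        push_cast
        rcases hn with rfl | rfl
        · have h3 := h3 rfl
          refine ⟨key ?_ ?_, key ?_ ?_, fun h => by omega, fun h => key ?_ ?_⟩ <;> linarith
        · have h4 := h4 rfl
          push_cast at *
          refine ⟨key ?_ ?_, key ?_ ?_, fun h => by omega, fun h => key ?_ ?_⟩ <;> linarith
      · have hp' : p j < 0 := by rw [hp] at hb; linarith
        simp only [ha, hb, if_false]
        rcases hn with rfl | rfl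
        · have h3 := h3 rfl
          refine ⟨key ?_ ?_, key ?_ ?_, fun h => key ?_ ?_, fun h => by omega⟩ <;> linarith
        · have h4 := h4 rfl
          push_cast at *
          refine ⟨key ?_ ?_, key ?_ ?_, fun h => by omega, fun h => key ?_ ?_⟩ <;> linarith

/-- The slope of `F` between `i` and `j`. -/
noncomputable def slopeFrom (F : ℕ → ℝ) (i j : ℕ) : ℝ := (F j - F i) / ((j : ℝ) - i)

/-- The slopes of `F` from `i` to the points `i + 1, …, H`. -/
noncomputable def slopeList (F : ℕ → ℝ) (H i : ℕ) : List ℝ :=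
  (List.range' (i + 1) (H - i)).map (slopeFrom F i)

/-- Upcrossing inequality for the one-sided averages of a nonnegative sequence. -/
lemma sum_crossings_le_aux {F : ℕ → ℝ} (hF : Monotone F) {a b : ℝ} (ha : 0 ≤ a) (hab : a < b)
    (H n : ℕ) : ∀ i, i + n = H →
    max (tradeVal (fun j => F j - F i - b * ((j : ℝ) - i)) (fun j => F j - F i - a * ((j : ℝ) - i))
        (F 0 - F i - a * n) (List.range' (i + 1) n)).1
      (tradeVal (fun j => F j - F i - b * ((j : ℝ) - i)) (fun j => F j - F i - a * ((j : ℝ) - i))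
        (F 0 - F i - a * n) (List.range' (i + 1) n)).2
      + (b - a) * ∑ k ∈ Finset.Ico i H, ((crossings a b (slopeList F H k)).2 : ℝ) ≤ F H - F i := by
  induction n with
  | zero =>
    rintro i rfl
    simpa [tradeVal] using hF (Nat.zero_le i)
  | succ n ih =>
    intro i hi
    have ih := ih (i + 1) (by omega)
    rw [Finset.sum_eq_sum_Ico_succ_bot (by omega)]
    have hz : F 0 - F i - a * (n + 1 : ℕ) ≤ 0 := by
      have := hF (Nat.zero_le i)
      have : 0 ≤ a * (n + 1 : ℕ) := by positivity
      linarith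
    have hu : F i ≤ F (i + 1) := hF (Nat.le_succ i)
    have main := tradeVal_add_crossings_le hab (sub_nonneg.2 hab.le) hz
      (fun j => F j - F i - b * ((j : ℝ) - i)) (fun j => F j - F i - a * ((j : ℝ) - i))
      (slopeFrom F i) (List.range' (i + 1) (n + 1)) (by
        intro j hj
        have hj' : (0 : ℝ) < (j : ℝ) - i := by
          have : i < j := by simp [List.mem_range'] at hj; omega
          have : (i : ℝ) < j := by exact_mod_cast this
          linarith
        simp only [slopeFrom, div_le_iff₀ hj', le_div_iff₀ hj', sub_nonneg, sub_nonpos, and_self])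
    have hH : H - i = n + 1 := by omega
    rw [show (List.range' (i + 1) (n + 1)).map (slopeFrom F i) = slopeList F H i by
      rw [slopeList, hH]] at main
    obtain ⟨T, hT⟩ : ∃ T, tradeVal (fun j => F j - F (i + 1) - b * ((j : ℝ) - (i + 1 : ℕ)))
      (fun j => F j - F (i + 1) - a * ((j : ℝ) - (i + 1 : ℕ)))
      (F 0 - F (i + 1) - a * n) (List.range' (i + 1 + 1) n) = T := ⟨_, rfl⟩
    have hshift := tradeVal_shift (fun j => F j - F (i + 1) - b * ((j : ℝ) - (i + 1 : ℕ)))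
      (fun j => F j - F (i + 1) - a * ((j : ℝ) - (i + 1 : ℕ)))
      (F 0 - F (i + 1) - a * n) (F (i + 1) - F i - a) (List.range' (i + 1 + 1) n)
    rw [hT, tradeVal_congr (p' := fun j => F j - F i - b * ((j : ℝ) - i) + (b - a))
      (c' := fun j => F j - F i - a * ((j : ℝ) - i)) (fun j _ => by push_cast; ring)
      (fun j _ => by push_cast; ring),
      show F 0 - F (i + 1) - a * n + (F (i + 1) - F i - a) = F 0 - F i - a * (n + 1 : ℕ) by
        push_cast; ring] at hshift
    rw [hT] at ih
    obtain ⟨m1, m2, m3, m4⟩ := main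
    obtain ⟨k1, k2⟩ := crossings_fst_le_snd a b (slopeList F H i)
    have e1 : tradeVal (fun j => F j - F i - b * ((j : ℝ) - i) + (b - a))
        (fun j => F j - F i - a * ((j : ℝ) - i)) (F 0 - F i - a * (n + 1 : ℕ))
        (List.range' (i + 1) (n + 1)) =
        (max T.1 T.2, max T.1 T.2 + (F (i + 1) - F i - a)) := by
      rw [List.range'_succ, tradeVal, hshift]
      simp only [Prod.mk.injEq]
      constructor
      · congr 1; push_cast; ring
      · rw [max_comm T.1, ← max_add_add_right]; congr 1; push_cast; ring
    rw [e1] at m1 m2 m3 m4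
    clear e1 hshift hT
    simp only at m1 m2 m3 m4
    generalize max T.1 T.2 = S at *
    generalize (crossings a b (slopeList F H i)).1 = x at *
    generalize (crossings a b (slopeList F H i)).2 = y at *
    have hy : y = x ∨ y = x + 1 := by omega
    generalize tradeVal _ _ _ (List.range' (i + 1) (n + 1)) = T' at *
    rw [mul_add]
    rcases max_choice T'.1 T'.2 with h | h
    · rw [h]
      rcases hy with rfl | rfl
      · linarith
      · have := m4 rfl
        linarith
    · rw [h]
      linarith

lemma sum_crossings_le {F : ℕ → ℝ} (hF : Monotone F) {a b : ℝ} (ha : 0 ≤ a) (hab : a < b)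
    (H : ℕ) : (b - a) * ∑ k ∈ Finset.range H, ((crossings a b (slopeList F H k)).2 : ℝ) ≤
      F H - F 0 := by
  have h := sum_crossings_le_aux hF ha hab H H 0 (by simp)
  have h0 : ∀ (p c : ℕ → ℝ) z l, 0 ≤ (tradeVal p c z l).1 := by
    intro p c z l
    induction l with
    | nil => exact le_rfl
    | cons j l ih => exact ih.trans (le_max_left _ _)
  rw [Finset.range_eq_Ico]
  exact (le_add_of_nonneg_left ((h0 _ _ _ _).trans (le_max_left _ _))).trans h

lemma crossings_le_of_sublist (a b : ℝ) {l l' : List ℝ} (h : l.Sublist l') :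
    (crossings a b l).1 ≤ (crossings a b l').1 ∧ (crossings a b l).2 ≤ (crossings a b l').2 := by
  induction h with
  | slnil => simp
  | @cons l l' v _ ih =>
    have := crossings_fst_le_snd a b l'
    simp only [crossings]
    split_ifs <;> omega
  | @cons_cons l l' v _ ih =>
    simp only [crossings]
    split_ifs <;> omega

lemma sum_step_crossings_le {a b : ℝ} (hab : a < b) {n : ℕ} (g : Fin (n + 1) → ℝ) :
    ∑ i : Fin n, (if (g i.castSucc ≤ a ∧ b ≤ g i.succ) ∨ (g i.succ ≤ a ∧ b ≤ g i.castSucc)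
      then 1 else 0) ≤ (crossings a b (List.ofFn g)).1 + (crossings a b (List.ofFn g)).2 := by
  induction n with
  | zero => simp
  | succ n ih =>
    have ih := ih (fun i => g i.succ)
    have h1 := crossings_fst_le_snd a b (List.ofFn fun i => g i.succ)
    have h2 : List.ofFn (fun i => g i.succ) = g 1 :: List.ofFn (fun i => g (Fin.succ (Fin.succ i))) := by
      rw [List.ofFn_succ]; rfl
    have h3 : (g 1 ≤ a → (crossings a b (List.ofFn fun i => g i.succ)).1 =
          (crossings a b (List.ofFn fun i => g i.succ)).2) ∧
        (b ≤ g 1 → (crossings a b (List.ofFn fun i => g i.succ)).2 =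
          (crossings a b (List.ofFn fun i => g i.succ)).1 + 1) := by
      rw [h2]
      simp only [crossings]
      constructor
      · intro h; rw [if_pos h, if_neg (by linarith)]
      · intro h; rw [if_pos h, if_neg (by linarith)]
    rw [Fin.sum_univ_succ, List.ofFn_succ]
    simp only [Fin.castSucc_zero, Fin.succ_zero_eq_one, ← Fin.succ_castSucc]
    generalize (∑ i : Fin n, (_ : ℕ)) = s at *
    simp only [crossings]
    generalize crossings a b (List.ofFn fun i => g i.succ) = N at *
    clear h2
    grind

lemma exists_dyadic_between {x y : ℝ} (hx : 0 ≤ x) (hy : y ≤ 1) (hxy : x < y) :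
    ∃ k m : ℕ, m < 2 ^ k ∧ x ≤ m / 2 ^ k ∧ ((m : ℝ) + 1) / 2 ^ k ≤ y ∧
      y - x ≤ 4 * (1 / 2) ^ k := by
  obtain ⟨n, h1, h2⟩ := exists_nat_pow_near_of_lt_one (sub_pos.2 hxy)
    (by linarith : y - x ≤ 1) (by norm_num : (0 : ℝ) < 1 / 2) (by norm_num)
  have h2k : (0 : ℝ) < 2 ^ (n + 2) := by positivity
  have e : ((1 / 2 : ℝ)) ^ (n + 1) = 2 / 2 ^ (n + 2) := by
    rw [one_div, inv_pow]; field_simp; ring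
  rw [e, div_lt_iff₀ h2k] at h1
  have c1 := Nat.le_ceil (x * 2 ^ (n + 2))
  have c2 := Nat.ceil_lt_add_one (by positivity : 0 ≤ x * 2 ^ (n + 2))
  have c3 : y * 2 ^ (n + 2) ≤ 2 ^ (n + 2) := mul_le_of_le_one_left h2k.le hy
  refine ⟨n + 2, ⌈x * 2 ^ (n + 2)⌉₊, ?_, ?_, ?_, ?_⟩
  · have : ((⌈x * 2 ^ (n + 2)⌉₊ : ℕ) : ℝ) < ((2 ^ (n + 2) : ℕ) : ℝ) := by push_cast; linarith
    exact_mod_cast this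
  · rwa [le_div_iff₀ h2k]
  · rw [div_le_iff₀ h2k]; linarith
  · calc y - x ≤ (1 / 2) ^ n := h2
      _ = 4 * (1 / 2) ^ (n + 2) := by ring

/-- Weighted sum of the crossing numbers over all dyadic subintervals of `[0, 1]`. -/
noncomputable def dyadicCrossings (ρ : ℝ) (l : List ℝ) : ℝ≥0∞ :=
  ∑' k : ℕ, ∑ m ∈ Finset.range (2 ^ k), ENNReal.ofReal (4 * (1 / 2) ^ k) ^ ρ *
    (2 * ((crossings (m / 2 ^ k) ((m + 1) / 2 ^ k) l).2 : ℝ≥0∞))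

lemma sum_rpow_le_dyadicCrossings {ρ : ℝ} (hρ : 0 < ρ) {n : ℕ} (g : Fin (n + 1) → ℝ)
    (hg : ∀ i, g i ∈ Icc (0 : ℝ) 1) :
    ∑ i : Fin n, ENNReal.ofReal |g i.succ - g i.castSucc| ^ ρ ≤
      dyadicCrossings ρ (List.ofFn g) := by
  have step : ∀ i : Fin n, ENNReal.ofReal |g i.succ - g i.castSucc| ^ ρ ≤
      ∑' k : ℕ, ∑ m ∈ Finset.range (2 ^ k), ENNReal.ofReal (4 * (1 / 2) ^ k) ^ ρ *
        (if (g i.castSucc ≤ m / 2 ^ k ∧ ((m : ℝ) + 1) / 2 ^ k ≤ g i.succ) ∨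
          (g i.succ ≤ m / 2 ^ k ∧ ((m : ℝ) + 1) / 2 ^ k ≤ g i.castSucc)
          then (1 : ℕ) else 0 : ℕ) := by
    intro i
    have main : ∀ k m : ℕ, m < 2 ^ k → ((g i.castSucc ≤ m / 2 ^ k ∧
        ((m : ℝ) + 1) / 2 ^ k ≤ g i.succ) ∨
        (g i.succ ≤ m / 2 ^ k ∧ ((m : ℝ) + 1) / 2 ^ k ≤ g i.castSucc)) →
        |g i.succ - g i.castSucc| ≤ 4 * (1 / 2) ^ k →
        ENNReal.ofReal |g i.succ - g i.castSucc| ^ ρ ≤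
      ∑' k : ℕ, ∑ m ∈ Finset.range (2 ^ k), ENNReal.ofReal (4 * (1 / 2) ^ k) ^ ρ *
        (if (g i.castSucc ≤ m / 2 ^ k ∧ ((m : ℝ) + 1) / 2 ^ k ≤ g i.succ) ∨
          (g i.succ ≤ m / 2 ^ k ∧ ((m : ℝ) + 1) / 2 ^ k ≤ g i.castSucc)
          then (1 : ℕ) else 0 : ℕ) := by
      intro k m hm hcr hle
      refine le_trans ?_ (ENNReal.le_tsum k)
      refine le_trans ?_ (Finset.single_le_sum (fun _ _ => zero_le) (Finset.mem_range.2 hm))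
      rw [if_pos hcr, Nat.cast_one, mul_one]
      gcongr
    rcases lt_trichotomy (g i.castSucc) (g i.succ) with h | h | h
    · obtain ⟨k, m, hm, h1, h2, h3⟩ := exists_dyadic_between (hg _).1 (hg _).2 h
      exact main k m hm (Or.inl ⟨h1, h2⟩) (by rwa [abs_of_pos (sub_pos.2 h)])
    · simp [h, hρ]
    · obtain ⟨k, m, hm, h1, h2, h3⟩ := exists_dyadic_between (hg _).1 (hg _).2 h
      exact main k m hm (Or.inr ⟨h1, h2⟩) (by rwa [abs_sub_comm, abs_of_pos (sub_pos.2 h)])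
  refine (Finset.sum_le_sum fun i _ => step i).trans ?_
  rw [← Summable.tsum_finsetSum (fun _ _ => ENNReal.summable)]
  refine ENNReal.tsum_le_tsum fun k => ?_
  rw [Finset.sum_comm]
  refine Finset.sum_le_sum fun m _ => ?_
  rw [← Finset.mul_sum, ← Nat.cast_sum]
  gcongr
  have h2k : (0 : ℝ) < 2 ^ k := by positivity
  have hab : (m : ℝ) / 2 ^ k < (m + 1) / 2 ^ k := by gcongr; linarith
  have := sum_step_crossings_le hab g
  have := crossings_fst_le_snd ((m : ℝ) / 2 ^ k) ((m + 1) / 2 ^ k) (List.ofFn g)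
  have h : (∑ i : Fin n, (if (g i.castSucc ≤ m / 2 ^ k ∧ ((m : ℝ) + 1) / 2 ^ k ≤ g i.succ) ∨
          (g i.succ ≤ m / 2 ^ k ∧ ((m : ℝ) + 1) / 2 ^ k ≤ g i.castSucc) then 1 else 0)) ≤
      2 * (crossings (m / 2 ^ k) ((m + 1) / 2 ^ k) (List.ofFn g)).2 := by omega
  exact_mod_cast h

lemma dyadicCrossings_le_of_sublist (ρ : ℝ) {l l' : List ℝ} (h : l.Sublist l') :
    dyadicCrossings ρ l ≤ dyadicCrossings ρ l' := by
  unfold dyadicCrossings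
  gcongr
  exact (crossings_le_of_sublist _ _ h).2

/-- The constant in the weak type bound for the variation of one-sided averages. -/
noncomputable def varConst (ρ : ℝ) : ℝ≥0∞ :=
  1 + ∑' k : ℕ, ENNReal.ofReal (4 * (1 / 2) ^ k) ^ ρ * (2 * (2 ^ k * 2 ^ k))

lemma varConst_ne_top {ρ : ℝ} (hρ : 2 < ρ) : varConst ρ ≠ ∞ := by
  have e : ∀ k : ℕ, ENNReal.ofReal (4 * (1 / 2) ^ k) ^ ρ * (2 * (2 ^ k * 2 ^ k)) =
      ENNReal.ofReal (4 ^ ρ * 2) * ENNReal.ofReal ((1 / 2) ^ ρ * 4) ^ k := by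
    intro k
    rw [ENNReal.ofReal_rpow_of_nonneg (by positivity) (by linarith), ← mul_pow,
      ← ENNReal.ofReal_pow (by positivity), ← ENNReal.ofReal_mul (by positivity),
      show (2 * (2 * 2) ^ k : ℝ≥0∞) = ENNReal.ofReal (2 * 4 ^ k) by
        rw [ENNReal.ofReal_mul (by norm_num), ENNReal.ofReal_pow (by norm_num)]; norm_num,
      ← ENNReal.ofReal_mul (by positivity)]
    congr 1
    rw [Real.mul_rpow (by norm_num) (by positivity), ← Real.rpow_natCast (1 / 2) k,
      ← Real.rpow_mul (by norm_num), mul_comm (k : ℝ) ρ, Real.rpow_mul (by norm_num),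
      Real.rpow_natCast, mul_pow]
    ring
  have h4 : (1 / 2 : ℝ) ^ ρ * 4 < 1 := by
    have : (1 / 2 : ℝ) ^ ρ < (1 / 2 : ℝ) ^ (2 : ℝ) :=
      Real.rpow_lt_rpow_of_exponent_gt (by norm_num) (by norm_num) hρ
    rw [Real.rpow_two] at this
    linarith
  unfold varConst
  simp_rw [e]
  rw [ENNReal.tsum_mul_left, ENNReal.tsum_geometric]
  refine ENNReal.add_ne_top.2 ⟨by simp, ENNReal.mul_ne_top (by simp) ?_⟩
  rw [ENNReal.inv_ne_top]
  have : ENNReal.ofReal ((1 / 2) ^ ρ * 4) < 1 := by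
    rw [ENNReal.ofReal_lt_one]; exact h4
  exact (tsub_pos_of_lt this).ne'

lemma sum_crossings_dyadic_le {F : ℕ → ℝ} (hF : Monotone F) (H k m : ℕ) :
    ∑ i ∈ Finset.range H, ((crossings (m / 2 ^ k) ((m + 1) / 2 ^ k) (slopeList F H i)).2 : ℝ≥0∞)
      ≤ 2 ^ k * ENNReal.ofReal (F H - F 0) := by
  have h2k : (0 : ℝ) < 2 ^ k := by positivity
  have h := sum_crossings_le hF (a := (m : ℝ) / 2 ^ k) (b := (m + 1) / 2 ^ k) (by positivity)
    (by gcongr; linarith) H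
  rw [← _root_.sub_div, add_sub_cancel_left, one_div, inv_mul_le_iff₀ h2k] at h
  have h := ENNReal.ofReal_le_ofReal h
  rw [ENNReal.ofReal_mul h2k.le, ENNReal.ofReal_pow (by norm_num), ENNReal.ofReal_ofNat] at h
  refine le_trans (le_of_eq ?_) h
  rw [ENNReal.ofReal_sum_of_nonneg (fun _ _ => by positivity)]
  simp

lemma sum_dyadicCrossings_le (ρ : ℝ) {F : ℕ → ℝ} (hF : Monotone F) (H : ℕ) :
    ∑ i ∈ Finset.range H, (((crossings 0 1 (slopeList F H i)).2 : ℝ≥0∞) +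
      dyadicCrossings ρ (slopeList F H i)) ≤ varConst ρ * ENNReal.ofReal (F H - F 0) := by
  rw [Finset.sum_add_distrib, varConst, add_mul]
  refine add_le_add ?_ ?_
  · simpa using sum_crossings_dyadic_le hF H 0 0
  unfold dyadicCrossings
  rw [← Summable.tsum_finsetSum (fun _ _ => ENNReal.summable), ← ENNReal.tsum_mul_right]
  refine ENNReal.tsum_le_tsum fun k => ?_
  rw [Finset.sum_comm]
  calc _ ≤ ∑ m ∈ Finset.range (2 ^ k), ENNReal.ofReal (4 * (1 / 2) ^ k) ^ ρ *
        (2 * (2 ^ k * ENNReal.ofReal (F H - F 0))) := by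
        refine Finset.sum_le_sum fun m _ => ?_
        rw [← Finset.mul_sum, ← Finset.mul_sum]
        gcongr
        exact sum_crossings_dyadic_le hF H k m
    _ = _ := by
        rw [Finset.sum_const, Finset.card_range, nsmul_eq_mul]
        push_cast
        ring

lemma one_le_crossings_add {ρ : ℝ} (hρ : 0 < ρ) {F : ℕ → ℝ} (hF : Monotone F) {H i n : ℕ}
    (t : Fin (n + 1) → ℕ) (ht : StrictMono t) (hi : ∀ k, i < t k) (hH : ∀ k, t k ≤ H)
    (h : 1 < ∑ k : Fin n,
      ENNReal.ofReal |slopeFrom F i (t k.succ) - slopeFrom F i (t k.castSucc)| ^ ρ) :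
    1 ≤ ((crossings 0 1 (slopeList F H i)).2 : ℝ≥0∞) + dyadicCrossings ρ (slopeList F H i) := by
  have hsub : (List.ofFn fun k => slopeFrom F i (t k)).Sublist (slopeList F H i) := by
    have : (List.ofFn t).Sublist (List.range' (i + 1) (H - i)) := by
      refine List.sublist_of_subperm_of_sortedLE (List.subperm_of_subset
        (List.nodup_ofFn.2 ht.injective) ?_) (List.sortedLE_ofFn_iff.2 ht.monotone) ?_
      · intro j hj
        obtain ⟨k, rfl⟩ := List.mem_ofFn.1 hj
        rw [List.mem_range'_1]
        have := hi k
        have := hH k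
        omega
      · exact ((List.pairwise_lt_range' (s := i + 1) (n := H - i)).imp le_of_lt).sortedLE
    have := this.map (slopeFrom F i)
    rwa [List.map_ofFn] at this
  by_cases hle : ∀ k, slopeFrom F i (t k) ≤ 1
  · refine le_trans ?_ le_add_self
    refine h.le.trans ?_
    refine (sum_rpow_le_dyadicCrossings hρ (fun k => slopeFrom F i (t k)) fun k => ⟨?_, hle k⟩).trans
      (dyadicCrossings_le_of_sublist ρ hsub)
    have h1 : (i : ℝ) < t k := by exact_mod_cast hi k
    exact div_nonneg (sub_nonneg.2 (hF (hi k).le)) (by linarith)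
  · push Not at hle
    obtain ⟨k, hk⟩ := hle
    refine le_trans ?_ le_self_add
    have h1 : [slopeFrom F i (t k)].Sublist (slopeList F H i) :=
      (List.singleton_sublist.2 (List.mem_ofFn.2 ⟨k, rfl⟩)).trans hsub
    have h2 := (crossings_le_of_sublist 0 1 h1).2
    simp only [crossings, hk.le, if_true] at h2
    exact_mod_cast h2

/-- The slope of `Φ` between `x` and `x + s`. -/
noncomputable def fwdSlope (Φ : ℝ → ℝ) (s x : ℝ) : ℝ := (Φ (x + s) - Φ x) / s

/-- The points at which the variation of the forward slopes along the multiples of `2 ^ (-m)`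
up to `2 ^ m` exceeds `1`. -/
def gridVarSet (ρ : ℝ) (Φ : ℝ → ℝ) (m : ℕ) : Set ℝ :=
  {x | ∃ (n : ℕ) (t : Fin (n + 1) → ℕ), StrictMono t ∧ (∀ k, 0 < t k) ∧ (∀ k, t k ≤ 4 ^ m) ∧
    1 < ∑ k : Fin n, ENNReal.ofReal |fwdSlope Φ (t k.succ / 2 ^ m) x -
      fwdSlope Φ (t k.castSucc / 2 ^ m) x| ^ ρ}

lemma isOpen_gridVarSet (ρ : ℝ) {Φ : ℝ → ℝ} (hΦ : Continuous Φ) (m : ℕ) :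
    IsOpen (gridVarSet ρ Φ m) := by
  simp only [gridVarSet, ofPred_exists]
  refine isOpen_iUnion fun n => isOpen_iUnion fun t => ?_
  simp only [← and_assoc, ofPred_and]
  refine IsOpen.inter (IsOpen.inter (IsOpen.inter isOpen_const isOpen_const) isOpen_const) ?_
  refine isOpen_lt continuous_const (continuous_finsetSum _ fun k _ => ?_)
  refine (ENNReal.continuous_rpow_const).comp (ENNReal.continuous_ofReal.comp ?_)
  unfold fwdSlope
  fun_prop

lemma gridVarSet_mono (ρ : ℝ) (Φ : ℝ → ℝ) : Monotone (gridVarSet ρ Φ) := by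
  refine monotone_nat_of_le_succ fun m x => ?_
  rintro ⟨n, t, ht, h0, h1, h⟩
  refine ⟨n, fun k => 2 * t k, fun i j hij => by have := ht hij; simp only; omega,
    fun k => by have := h0 k; dsimp only; omega, fun k => ?_, ?_⟩
  · have := h1 k
    rw [pow_succ]; dsimp only; omega
  · have e : ∀ k, ((2 * t k : ℕ) : ℝ) / 2 ^ (m + 1) = t k / 2 ^ m := by
      intro k; push_cast; rw [pow_succ]; field_simp
    simpa only [e] using h

lemma sum_indicator_gridVarSet_le {ρ : ℝ} (hρ : 0 < ρ) {Φ : ℝ → ℝ} (hm : Monotone Φ) {K : ℝ}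
    (hK : ∀ x y, Φ y - Φ x ≤ K) (m N : ℕ) (x : ℝ) :
    ∑ i ∈ Finset.range N, indicator (gridVarSet ρ Φ m) (1 : ℝ → ℝ≥0∞) (x + i / 2 ^ m) ≤
      varConst ρ * ENNReal.ofReal (K * 2 ^ m) := by
  have h2 : (0 : ℝ) < 2 ^ m := by positivity
  set F : ℕ → ℝ := fun j => Φ (x + j / 2 ^ m) * 2 ^ m with hFdef
  have hF : Monotone F := by
    intro i j hij
    have : (i : ℝ) ≤ j := by exact_mod_cast hij
    simp only [F]
    gcongr
    exact hm (by gcongr)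
  have hs : ∀ i j : ℕ, slopeFrom F i (i + j) = fwdSlope Φ (j / 2 ^ m) (x + i / 2 ^ m) := by
    intro i j
    simp only [slopeFrom, fwdSlope, F]
    rw [show x + ((i + j : ℕ) : ℝ) / 2 ^ m = x + i / 2 ^ m + j / 2 ^ m by push_cast; ring,
      ← sub_mul, div_div_eq_mul_div]
    push_cast
    rw [add_sub_cancel_left]
  calc _ ≤ ∑ i ∈ Finset.range N, (((crossings 0 1 (slopeList F (N + 4 ^ m) i)).2 : ℝ≥0∞) +
        dyadicCrossings ρ (slopeList F (N + 4 ^ m) i)) := by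
        refine Finset.sum_le_sum fun i hi => ?_
        by_cases hx : x + i / 2 ^ m ∈ gridVarSet ρ Φ m
        · rw [indicator_of_mem hx, Pi.one_apply]
          obtain ⟨n, t, ht, h0, h1, h⟩ := hx
          refine one_le_crossings_add hρ hF (fun k => i + t k) (fun a b hab => ?_)
            (fun k => ?_) (fun k => ?_) ?_
          · have := ht hab
            simp only; omega
          · have := h0 k
            omega
          · have := h1 k
            rw [Finset.mem_range] at hi
            omega
          · simpa only [hs] using h
        · rw [indicator_of_notMem hx]
          exact zero_le
    _ ≤ ∑ i ∈ Finset.range (N + 4 ^ m), (((crossings 0 1 (slopeList F (N + 4 ^ m) i)).2 : ℝ≥0∞) +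
        dyadicCrossings ρ (slopeList F (N + 4 ^ m) i)) :=
        Finset.sum_le_sum_of_subset (Finset.range_mono (Nat.le_add_right _ _))
    _ ≤ varConst ρ * ENNReal.ofReal (F (N + 4 ^ m) - F 0) := sum_dyadicCrossings_le ρ hF _
    _ ≤ _ := by
        gcongr
        simp only [F]
        rw [← sub_mul]
        gcongr
        exact hK _ _

lemma volume_inter_Ico_le_sum (E : Set ℝ) (d c : ℝ) (N : ℕ) :
    volume (E ∩ Ico c (c + N * d)) ≤
      ∑ i ∈ Finset.range N, volume.restrict (Ico c (c + d)) ((fun x => x + i * d) ⁻¹' E) := by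
  induction N with
  | zero => simp
  | succ N ih =>
    rw [Finset.sum_range_succ]
    have hsub : E ∩ Ico c (c + (N + 1 : ℕ) * d) ⊆ (E ∩ Ico c (c + N * d)) ∪
        (E ∩ Ico (c + N * d) (c + (N + 1 : ℕ) * d)) := by
      rintro x ⟨hx, h1, h2⟩
      rcases lt_or_ge x (c + N * d) with h | h
      · exact Or.inl ⟨hx, h1, h⟩
      · exact Or.inr ⟨hx, h, h2⟩
    refine (measure_mono hsub).trans ((measure_union_le _ _).trans (add_le_add ih ?_))
    rw [Measure.restrict_apply' measurableSet_Ico,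
      ← measure_preimage_add_right volume (N * d) (E ∩ Ico (c + N * d) (c + (N + 1 : ℕ) * d))]
    refine measure_mono ?_
    rintro x ⟨hx, h1, h2⟩
    simp only at *
    push_cast at h2
    exact ⟨hx, by linarith, by linarith⟩

lemma volume_gridVarSet_le {ρ : ℝ} (hρ : 0 < ρ) {Φ : ℝ → ℝ} (hm : Monotone Φ)
    (hΦ : Continuous Φ) {K : ℝ} (hK : ∀ x y, Φ y - Φ x ≤ K) (m : ℕ) :
    volume (gridVarSet ρ Φ m) ≤ varConst ρ * ENNReal.ofReal K := by
  have h2 : (0 : ℝ) < 2 ^ m := by positivity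
  have hE := (isOpen_gridVarSet ρ hΦ m).measurableSet
  have hunion : gridVarSet ρ Φ m = ⋃ n : ℕ, gridVarSet ρ Φ m ∩ Ico (-(n : ℝ)) n := by
    rw [← inter_iUnion, eq_comm, inter_eq_left]
    intro x _
    obtain ⟨n, hn⟩ := exists_nat_gt |x|
    rw [abs_lt] at hn
    exact mem_iUnion.2 ⟨n, hn.1.le, hn.2⟩
  have hmono : Monotone fun n : ℕ => gridVarSet ρ Φ m ∩ Ico (-(n : ℝ)) n := by
    intro i j hij
    have : (i : ℝ) ≤ j := by exact_mod_cast hij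
    exact inter_subset_inter_right _ (Ico_subset_Ico (by linarith) this)
  rw [hunion, hmono.measure_iUnion]
  refine iSup_le fun n => ?_
  have h := volume_inter_Ico_le_sum (gridVarSet ρ Φ m) (1 / 2 ^ m) (-(n : ℝ))
    (2 * n * 2 ^ m)
  rw [show -(n : ℝ) + ((2 * n * 2 ^ m : ℕ) : ℝ) * (1 / 2 ^ m) = n by
    push_cast; field_simp; ring] at h
  refine h.trans ?_
  have hpre : ∀ i : ℕ, MeasurableSet ((fun x : ℝ => x + i * (1 / 2 ^ m)) ⁻¹' gridVarSet ρ Φ m) :=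
    fun i => hE.preimage (by fun_prop)
  simp_rw [← fun i => lintegral_indicator_one (μ := volume.restrict
    (Ico (-(n : ℝ)) (-(n : ℝ) + 1 / 2 ^ m))) (hpre i)]
  rw [← lintegral_finsetSum _ (fun i _ => measurable_one.indicator (hpre i))]
  calc _ ≤ ∫⁻ x in Ico (-(n : ℝ)) (-(n : ℝ) + 1 / 2 ^ m),
        varConst ρ * ENNReal.ofReal (K * 2 ^ m) := by
        refine lintegral_mono fun x => ?_
        have := sum_indicator_gridVarSet_le hρ hm hK m (2 * n * 2 ^ m) x
        refine le_trans (le_of_eq ?_) this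
        refine Finset.sum_congr rfl fun i _ => ?_
        rw [div_eq_mul_one_div (i : ℝ) (2 ^ m)]
        rfl
    _ = _ := by
        rw [lintegral_const, Measure.restrict_apply_univ, Real.volume_Ico, add_sub_cancel_left,
          mul_assoc, ← ENNReal.ofReal_mul' (by positivity)]
        congr 2
        field_simp

lemma exists_mem_gridVarSet {ρ : ℝ} (hρ : 0 < ρ) {Φ : ℝ → ℝ} (hΦ : Continuous Φ) {x : ℝ}
    (hx : 1 < varNorm ρ (Ioi (0 : ℝ)) (fun s => fwdSlope Φ s x)) :
    ∃ m, x ∈ gridVarSet ρ Φ m := by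
  simp only [varNorm, lt_iSup_iff] at hx
  obtain ⟨n, t, ht, h0, h⟩ := hx
  have h : 1 < ∑ i : Fin n,
      ENNReal.ofReal |fwdSlope Φ (t i.succ) x - fwdSlope Φ (t i.castSucc) x| ^ ρ := by
    by_contra! hle
    refine absurd h (not_lt.2 (ENNReal.rpow_le_one ?_ (by positivity)))
    refine le_trans (le_of_eq ?_) hle
    refine Finset.sum_congr rfl fun i _ => ?_
    rw [← Real.norm_eq_abs, ofReal_norm]
    rfl
  have hpow : Filter.Tendsto (fun m : ℕ => (2 : ℝ) ^ m) Filter.atTop Filter.atTop :=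
    tendsto_pow_atTop_atTop_of_one_lt (by norm_num)
  have hlim : ∀ k, Filter.Tendsto (fun m : ℕ => (⌈t k * 2 ^ m⌉₊ : ℝ) / 2 ^ m) Filter.atTop
      (nhds (t k)) := fun k =>
    (tendsto_nat_ceil_mul_div_atTop (le_of_lt (h0 k))).comp hpow
  have e1 : ∀ᶠ m : ℕ in Filter.atTop, ∀ i j, i < j →
      (⌈t i * 2 ^ m⌉₊ : ℝ) / 2 ^ m < (⌈t j * 2 ^ m⌉₊ : ℝ) / 2 ^ m := by
    rw [Filter.eventually_all]; intro i
    rw [Filter.eventually_all]; intro j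
    by_cases hij : i < j
    · filter_upwards [(hlim i).eventually_lt (hlim j) (ht hij)] with m hm _ using hm
    · exact Filter.Eventually.of_forall fun m h => absurd h hij
  have e2 : ∀ᶠ m : ℕ in Filter.atTop, ∀ i, (⌈t i * 2 ^ m⌉₊ : ℝ) / 2 ^ m < 2 ^ m := by
    rw [Filter.eventually_all]; intro i
    filter_upwards [(hlim i).eventually_lt_const (lt_add_one (t i)),
      hpow.eventually_ge_atTop (t i + 1)] with m h1 h2 using h1.trans_le h2
  have hcont : ∀ k, ContinuousAt (fun s => fwdSlope Φ s x) (t k) := by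
    intro k
    have : t k ≠ 0 := ne_of_gt (h0 k)
    unfold fwdSlope
    exact ContinuousAt.div (by fun_prop) continuousAt_id this
  have hsum : Filter.Tendsto (fun m : ℕ => ∑ k : Fin n,
      ENNReal.ofReal |fwdSlope Φ ((⌈t k.succ * 2 ^ m⌉₊ : ℝ) / 2 ^ m) x -
        fwdSlope Φ ((⌈t k.castSucc * 2 ^ m⌉₊ : ℝ) / 2 ^ m) x| ^ ρ) Filter.atTop
      (nhds (∑ i : Fin n,
        ENNReal.ofReal |fwdSlope Φ (t i.succ) x - fwdSlope Φ (t i.castSucc) x| ^ ρ)) := by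
    refine tendsto_finsetSum _ fun k _ => ?_
    have c1 := (hcont k.succ).tendsto.comp (hlim k.succ)
    have c2 := (hcont k.castSucc).tendsto.comp (hlim k.castSucc)
    exact ((ENNReal.continuous_rpow_const.comp ENNReal.continuous_ofReal).tendsto _).comp
      (c1.sub c2).abs
  have e3 := hsum.eventually_const_lt h
  obtain ⟨m, h1, h2, h3⟩ := (e1.and (e2.and e3)).exists
  have h2m : (0 : ℝ) < 2 ^ m := by positivity
  refine ⟨m, n, fun k => ⌈t k * 2 ^ m⌉₊, fun i j hij => ?_, fun k => ?_, fun k => ?_, h3⟩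
  · have := h1 i j hij
    rw [div_lt_div_iff_of_pos_right h2m] at this
    exact_mod_cast this
  · exact Nat.ceil_pos.2 (mul_pos (h0 k) h2m)
  · have := (h2 k).le
    rw [div_le_iff₀ h2m, ← mul_pow] at this
    norm_num at this
    exact_mod_cast this

lemma volume_one_lt_varNorm_fwdSlope_le {ρ : ℝ} (hρ : 0 < ρ) {Φ : ℝ → ℝ} (hm : Monotone Φ)
    (hΦ : Continuous Φ) {K : ℝ} (hK : ∀ x y, Φ y - Φ x ≤ K) :
    volume {x : ℝ | 1 < varNorm ρ (Ioi (0 : ℝ)) (fun s => fwdSlope Φ s x)} ≤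
      varConst ρ * ENNReal.ofReal K := by
  refine (measure_mono fun x hx => mem_iUnion.2 (exists_mem_gridVarSet hρ hΦ hx)).trans ?_
  rw [(gridVarSet_mono ρ Φ).measure_iUnion]
  exact iSup_le fun m => volume_gridVarSet_le hρ hm hΦ hK m

section varNorm

variable {ι E F G : Type*} [Preorder ι] [SeminormedAddGroup E] [SeminormedAddGroup F]
  [SeminormedAddGroup G] {ρ : ℝ} {S : Set ι}

lemma varNorm_le_add (hρ : 1 ≤ ρ) {a : ι → E} {b : ι → F} {c : ι → G} (B C : ℝ≥0∞)
    (h : ∀ s ∈ S, ∀ t ∈ S, ‖a t - a s‖ₑ ≤ B * ‖b t - b s‖ₑ + C * ‖c t - c s‖ₑ) :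
    varNorm ρ S a ≤ B * varNorm ρ S b + C * varNorm ρ S c := by
  have hρ0 : 0 < ρ := by linarith
  have key : ∀ (n : ℕ) (k : ℝ≥0∞) (u : Fin n → ℝ≥0∞),
      (∑ i, (k * u i) ^ ρ) ^ (1 / ρ) = k * (∑ i, u i ^ ρ) ^ (1 / ρ) := by
    intro n k u
    simp_rw [ENNReal.mul_rpow_of_nonneg _ _ hρ0.le]
    rw [← Finset.mul_sum, ENNReal.mul_rpow_of_nonneg _ _ (by positivity), ← ENNReal.rpow_mul,
      mul_one_div_cancel hρ0.ne', ENNReal.rpow_one]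
  refine iSup_le fun n => iSup_le fun t => iSup_le fun ht => iSup_le fun hS => ?_
  calc _ ≤ (∑ i : Fin n, (B * ‖b (t i.succ) - b (t i.castSucc)‖ₑ +
        C * ‖c (t i.succ) - c (t i.castSucc)‖ₑ) ^ ρ) ^ (1 / ρ) := by
        gcongr with i
        exact h _ (hS _) _ (hS _)
    _ ≤ _ := ENNReal.Lp_add_le _ _ _ hρ
    _ ≤ _ := by
        rw [key, key]
        gcongr
        · exact le_iSup_of_le n (le_iSup_of_le t (le_iSup_of_le ht (le_iSup_of_le hS le_rfl)))
        · exact le_iSup_of_le n (le_iSup_of_le t (le_iSup_of_le ht (le_iSup_of_le hS le_rfl)))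

lemma enorm_sub_le_varNorm (hρ : 0 < ρ) (a : ι → E) {s t : ι} (hs : s ∈ S) (ht : t ∈ S)
    (hst : s < t) : ‖a t - a s‖ₑ ≤ varNorm ρ S a := by
  refine le_iSup_of_le 1 (le_iSup_of_le ![s, t] (le_iSup_of_le ?_ (le_iSup_of_le ?_ ?_)))
  · intro i j hij
    fin_cases i <;> fin_cases j <;> simp_all
  · intro i
    fin_cases i <;> simpa
  · simp only [Fin.sum_univ_one]
    rw [← ENNReal.rpow_mul, mul_one_div_cancel hρ.ne', ENNReal.rpow_one]
    rfl

lemma varNorm_comp_div_two_le (a : ℝ → E) :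
    varNorm ρ (Ioi (0 : ℝ)) (fun t => a (t / 2)) ≤ varNorm ρ (Ioi (0 : ℝ)) a := by
  refine iSup_le fun n => iSup_le fun t => iSup_le fun ht => iSup_le fun hS => ?_
  refine le_iSup_of_le n (le_iSup_of_le (fun k => t k / 2) (le_iSup_of_le ?_
    (le_iSup_of_le ?_ le_rfl)))
  · intro i j hij
    have := ht hij
    dsimp only
    linarith
  · intro i
    have := hS i
    simp only [mem_Ioi] at *
    linarith

end varNorm

lemma volume_lt_of_le_add {U V W : ℝ → ℝ≥0∞} (hU : ∀ x, U x ≤ V x + W x) {C : ℝ≥0∞} {K : ℝ}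
    (hV : ∀ α : ℝ, 0 < α → volume {x | ENNReal.ofReal α < V x} ≤ C * ENNReal.ofReal (K / α))
    (hW : ∀ α : ℝ, 0 < α → volume {x | ENNReal.ofReal α < W x} ≤ C * ENNReal.ofReal (K / α))
    (α : ℝ) (hα : 0 < α) :
    volume {x | ENNReal.ofReal α < U x} ≤ 4 * C * ENNReal.ofReal (K / α) := by
  have hsub : {x | ENNReal.ofReal α < U x} ⊆
      {x | ENNReal.ofReal (α / 2) < V x} ∪ {x | ENNReal.ofReal (α / 2) < W x} := by
    intro x hx
    by_contra hcon
    simp only [mem_union, mem_ofPred_eq, not_or, not_lt] at hcon hx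
    refine absurd hx (not_lt.2 ((hU x).trans ((add_le_add hcon.1 hcon.2).trans ?_)))
    rw [← ENNReal.ofReal_add (by positivity) (by positivity), add_halves]
  refine (measure_mono hsub).trans ((measure_union_le _ _).trans
    ((add_le_add (hV _ (by positivity)) (hW _ (by positivity))).trans (le_of_eq ?_)))
  rw [show K / (α / 2) = 2 * (K / α) by field_simp, ENNReal.ofReal_mul (by norm_num),
    ENNReal.ofReal_ofNat]
  ring

lemma volume_lt_varNorm_fwdSlope_le {ρ : ℝ} (hρ : 1 ≤ ρ) {Φ : ℝ → ℝ} (hm : Monotone Φ)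
    (hΦ : Continuous Φ) {K : ℝ} (hK : ∀ x y, Φ y - Φ x ≤ K) (α : ℝ) (hα : 0 < α) :
    volume {x : ℝ | ENNReal.ofReal α < varNorm ρ (Ioi (0 : ℝ)) (fun s => fwdSlope Φ s x)} ≤
      varConst ρ * ENNReal.ofReal (K / α) := by
  refine (measure_mono fun x hx => ?_).trans (volume_one_lt_varNorm_fwdSlope_le (by linarith)
    (Φ := fun x => Φ x / α) (fun x y h => by have := hm h; dsimp only; gcongr)
    (hΦ.div_const α) (K := K / α) fun x y => by
      rw [← _root_.sub_div]; have := hK x y; gcongr)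
  simp only [mem_ofPred_eq] at hx ⊢
  by_contra! hle
  refine absurd hx (not_lt.2 ?_)
  have hs : ∀ s, fwdSlope Φ s x = α * fwdSlope (fun x => Φ x / α) s x := by
    intro s
    simp only [fwdSlope]
    field_simp
  have := varNorm_le_add hρ (S := Ioi (0 : ℝ)) (a := fun s => fwdSlope Φ s x)
    (b := fun s => fwdSlope (fun x => Φ x / α) s x)
    (c := fun s => fwdSlope (fun x => Φ x / α) s x) (ENNReal.ofReal α) 0 (by
      intro s _ t _
      rw [hs, hs, ← mul_sub, enorm_mul, Real.enorm_of_nonneg hα.le, zero_mul, add_zero])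
  rw [zero_mul, add_zero] at this
  exact this.trans (mul_le_of_le_one_right' hle)

/-- The average of `f` over the interval of length `t` centered at `x`. -/
noncomputable def centerAvg {E : Type*} [NormedAddCommGroup E] [NormedSpace ℝ E] (f : ℝ → E)
    (t x : ℝ) : E :=
  t⁻¹ • ∫ y in Icc (-(t / 2)) (t / 2), f (x - y)

lemma centerAvg_eq_fwdSlope {g : ℝ → ℝ} (hg : Integrable g) {t : ℝ} (ht : 0 < t) (x : ℝ) :
    centerAvg g t x = (fwdSlope (fun u => ∫ v in (0 : ℝ)..u, g v) (t / 2) x +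
      fwdSlope (fun u => -∫ v in (0 : ℝ)..(-u), g v) (t / 2) (-x)) / 2 := by
  have hi : ∀ a b, IntervalIntegrable g volume a b := fun a b => hg.intervalIntegrable
  rw [centerAvg, integral_Icc_eq_integral_Ioc,
    ← intervalIntegral.integral_of_le (by linarith), intervalIntegral.integral_comp_sub_left]
  simp only [fwdSlope, neg_add, neg_neg]
  rw [← intervalIntegral.integral_add_adjacent_intervals (hi 0 x) (hi x (x + t / 2)),
    ← intervalIntegral.integral_add_adjacent_intervals (hi 0 (x + -(t / 2))) (hi _ x),
    ← intervalIntegral.integral_add_adjacent_intervals (hi (x - t / 2) x) (hi _ (x - -(t / 2))),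
    sub_neg_eq_add, ← sub_eq_add_neg, smul_eq_mul]
  field_simp
  ring

lemma volume_lt_varNorm_centerAvg_of_nonneg {ρ : ℝ} (hρ : 1 ≤ ρ) {g : ℝ → ℝ}
    (hg : Integrable g) (h0 : ∀ x, 0 ≤ g x) {K : ℝ} (hK : ∫ x, g x ≤ K) (α : ℝ) (hα : 0 < α) :
    volume {x : ℝ | ENNReal.ofReal α < varNorm ρ (Ioi (0 : ℝ)) (fun t => centerAvg g t x)} ≤
      4 * varConst ρ * ENNReal.ofReal (K / α) := by
  have hi : ∀ a b, IntervalIntegrable g volume a b := fun a b => hg.intervalIntegrable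
  set Φ : ℝ → ℝ := fun u => ∫ v in (0 : ℝ)..u, g v with hΦ
  have hsub : ∀ x y, Φ y - Φ x = ∫ v in x..y, g v := fun x y =>
    intervalIntegral.integral_interval_sub_left (hi _ _) (hi _ _)
  have hmono : Monotone Φ := fun x y hxy => by
    rw [← sub_nonneg, hsub]
    exact intervalIntegral.integral_nonneg hxy fun v _ => h0 v
  have hcont : Continuous Φ := intervalIntegral.continuous_primitive hi 0
  have hle : ∀ x y, Φ y - Φ x ≤ K := by
    intro x y
    rcases le_total x y with h | h
    · rw [hsub, intervalIntegral.integral_of_le h]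
      exact (setIntegral_le_integral hg (Filter.Eventually.of_forall h0)).trans hK
    · have := hmono h
      have : 0 ≤ ∫ x, g x := integral_nonneg h0
      linarith
  have heq : ∀ x, ∀ t > 0, centerAvg g t x =
      (fwdSlope Φ (t / 2) x + fwdSlope (fun u => -Φ (-u)) (t / 2) (-x)) / 2 :=
    fun x t ht => centerAvg_eq_fwdSlope hg ht x
  clear_value Φ
  have hmono' : Monotone fun u => -Φ (-u) := fun x y h => neg_le_neg (hmono (neg_le_neg h))
  have hcont' : Continuous fun u => -Φ (-u) := by fun_prop
  have hle' : ∀ x y, -Φ (-y) - -Φ (-x) ≤ K := fun x y => by have := hle (-y) (-x); linarith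
  refine volume_lt_of_le_add
    (V := fun x => varNorm ρ (Ioi (0 : ℝ)) (fun s => fwdSlope Φ s x))
    (W := fun x => varNorm ρ (Ioi (0 : ℝ)) (fun s => fwdSlope (fun u => -Φ (-u)) s (-x)))
    (fun x => ?_) (volume_lt_varNorm_fwdSlope_le hρ hmono hcont hle) (fun β hβ => ?_) α hα
  · have := varNorm_le_add hρ (S := Ioi (0 : ℝ)) (a := fun t => centerAvg g t x)
      (b := fun t => fwdSlope Φ (t / 2) x)
      (c := fun t => fwdSlope (fun u => -Φ (-u)) (t / 2) (-x)) 1 1 (by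
        intro s hs t ht
        rw [heq x t ht, heq x s hs, one_mul, one_mul, ← _root_.sub_div, add_sub_add_comm]
        refine le_trans ?_ (enorm_add_le _ _)
        rw [enorm_le_iff_norm_le, norm_div, Real.norm_ofNat]
        exact half_le_self (norm_nonneg _))
    rw [one_mul, one_mul] at this
    exact this.trans (add_le_add (varNorm_comp_div_two_le fun s => fwdSlope Φ s x)
      (varNorm_comp_div_two_le fun s => fwdSlope (fun u => -Φ (-u)) s (-x)))
  · have := volume_lt_varNorm_fwdSlope_le hρ hmono' hcont' hle' β hβ
    rw [← Measure.measure_preimage_neg] at this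
    exact this

section centerAvg

variable {E : Type*} [NormedAddCommGroup E] [NormedSpace ℝ E]

lemma norm_centerAvg_le {f : ℝ → E} (hf : Integrable f) {t : ℝ} (ht : 0 < t) (x : ℝ) :
    ‖centerAvg f t x‖ ≤ t⁻¹ * ∫ y, ‖f y‖ := by
  rw [centerAvg, norm_smul, norm_inv, Real.norm_of_nonneg ht.le]
  gcongr
  refine (norm_integral_le_integral_norm _).trans ?_
  rw [← integral_sub_left_eq_self (fun y => ‖f y‖) volume x]
  exact setIntegral_le_integral (hf.comp_sub_left x).norm
    (Filter.Eventually.of_forall fun _ => norm_nonneg _)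

lemma centerAvg_sub {f g : ℝ → E} (hf : Integrable f) (hg : Integrable g) (t x : ℝ) :
    centerAvg (fun y => f y - g y) t x = centerAvg f t x - centerAvg g t x := by
  simp only [centerAvg]
  rw [integral_sub (hf.comp_sub_left x).integrableOn (hg.comp_sub_left x).integrableOn, smul_sub]

lemma enorm_centerAvg_le_varNorm {ρ : ℝ} (hρ : 0 < ρ) {f : ℝ → E} (hf : Integrable f) {t : ℝ}
    (ht : 0 < t) (x : ℝ) :
    ‖centerAvg f t x‖ₑ ≤ varNorm ρ (Ioi (0 : ℝ)) (fun t => centerAvg f t x) := by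
  have hlim : Filter.Tendsto (fun T => ‖centerAvg f T x‖ₑ) Filter.atTop (nhds 0) := by
    rw [← enorm_zero (E := E)]
    refine Filter.Tendsto.enorm ?_
    refine squeeze_zero_norm' ((Filter.eventually_gt_atTop 0).mono fun T hT =>
      norm_centerAvg_le hf hT x) ?_
    simpa using (tendsto_inv_atTop_zero (𝕜 := ℝ)).mul_const (∫ y, ‖f y‖)
  have h2 := (tendsto_const_nhds (x := varNorm ρ (Ioi (0 : ℝ)) (fun t => centerAvg f t x))
    (f := Filter.atTop)).add hlim
  rw [add_zero] at h2
  refine ge_of_tendsto h2 ((Filter.eventually_gt_atTop t).mono fun T hT => ?_)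
  calc ‖centerAvg f t x‖ₑ = ‖-(centerAvg f T x - centerAvg f t x) + centerAvg f T x‖ₑ := by
        congr 1; abel
    _ ≤ _ := enorm_add_le _ _
    _ ≤ _ := by
        rw [enorm_neg]
        gcongr
        exact enorm_sub_le_varNorm hρ (fun t => centerAvg f t x) (mem_Ioi.2 ht)
          (mem_Ioi.2 (ht.trans hT)) hT

end centerAvg

lemma volume_lt_varNorm_centerAvg_real {ρ : ℝ} (hρ : 1 ≤ ρ) {g : ℝ → ℝ} (hg : Integrable g)
    {K : ℝ} (hK : ∫ x, ‖g x‖ ≤ K) (α : ℝ) (hα : 0 < α) :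
    volume {x : ℝ | ENNReal.ofReal α < varNorm ρ (Ioi (0 : ℝ)) (fun t => centerAvg g t x)} ≤
      4 * (4 * varConst ρ) * ENNReal.ofReal (K / α) := by
  have hp := hg.pos_part
  have hn := hg.neg_part
  refine volume_lt_of_le_add (fun x => ?_)
    (volume_lt_varNorm_centerAvg_of_nonneg hρ hp (fun x => le_max_right _ _)
      ((integral_mono hp hg.norm fun x => max_le (le_abs_self _) (abs_nonneg _)).trans hK))
    (volume_lt_varNorm_centerAvg_of_nonneg hρ hn (fun x => le_max_right _ _)
      ((integral_mono hn hg.norm fun x => max_le (neg_le_abs _) (abs_nonneg _)).trans hK)) α hα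
  have heq : ∀ t, centerAvg g t x =
      centerAvg (fun y => max (g y) 0) t x - centerAvg (fun y => max (-g y) 0) t x := by
    intro t
    rw [← centerAvg_sub hp hn]
    congr 1
    funext y
    rcases le_total 0 (g y) with h | h <;> simp [h]
  have := varNorm_le_add hρ (S := Ioi (0 : ℝ)) (a := fun t => centerAvg g t x)
    (b := fun t => centerAvg (fun y => max (g y) 0) t x)
    (c := fun t => centerAvg (fun y => max (-g y) 0) t x) 1 1 (fun s _ t _ => by
      rw [heq t, heq s, one_mul, one_mul, sub_sub_sub_comm]
      exact enorm_sub_le)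
  rwa [one_mul, one_mul] at this

lemma volume_lt_varNorm_centerAvg_complex {ρ : ℝ} (hρ : 1 ≤ ρ) {f : ℝ → ℂ} (hf : Integrable f)
    {K : ℝ} (hK : ∫ x, ‖f x‖ ≤ K) (α : ℝ) (hα : 0 < α) :
    volume {x : ℝ | ENNReal.ofReal α < varNorm ρ (Ioi (0 : ℝ)) (fun t => centerAvg f t x)} ≤
      4 * (4 * (4 * varConst ρ)) * ENNReal.ofReal (K / α) := by
  have hre := hf.re
  have him := hf.im
  refine volume_lt_of_le_add (fun x => ?_)
    (volume_lt_varNorm_centerAvg_real hρ hre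
      ((integral_mono hre.norm hf.norm fun x => Complex.abs_re_le_norm _).trans hK))
    (volume_lt_varNorm_centerAvg_real hρ him
      ((integral_mono him.norm hf.norm fun x => Complex.abs_im_le_norm _).trans hK)) α hα
  have heq : ∀ t, centerAvg f t x = ((centerAvg (fun y => (f y).re) t x : ℝ) : ℂ) +
      ((centerAvg (fun y => (f y).im) t x : ℝ) : ℂ) * Complex.I := by
    intro t
    have := integral_re_add_im (hf.comp_sub_left x).integrableOn.integrable
      (μ := volume.restrict (Icc (-(t / 2)) (t / 2)))
    simp only [centerAvg, ← this, Complex.real_smul, smul_eq_mul]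
    push_cast
    simp
    ring
  have := varNorm_le_add hρ (S := Ioi (0 : ℝ)) (a := fun t => centerAvg f t x)
    (b := fun t => centerAvg (fun y => (f y).re) t x)
    (c := fun t => centerAvg (fun y => (f y).im) t x) 1 1 (fun s _ t _ => by
      rw [heq t, heq s, one_mul, one_mul, add_sub_add_comm, ← sub_mul, ← Complex.ofReal_sub,
        ← Complex.ofReal_sub]
      refine (enorm_add_le _ _).trans (le_of_eq ?_)
      rw [← ofReal_norm, ← ofReal_norm, ← ofReal_norm, ← ofReal_norm, norm_mul, Complex.norm_I,
        mul_one, Complex.norm_real, Complex.norm_real])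
  rwa [one_mul, one_mul] at this

lemma Qbil_eq_mul (f g : ℝ → ℂ) (t x : ℝ) :
    Qbil f g t x = centerAvg f t x * centerAvg g t x := by
  simp only [Qbil, centerAvg, integral_const_mul, integral_mul_const, Complex.real_smul]
  push_cast
  ring

lemma varNorm_Qbil_le {ρ : ℝ} (hρ : 1 ≤ ρ) {f g : ℝ → ℂ} (hf : Integrable f)
    (hg : Integrable g) (x : ℝ) :
    varNorm ρ (Ioi (0 : ℝ)) (fun t => Qbil f g t x) ≤
      2 * (varNorm ρ (Ioi (0 : ℝ)) (fun t => centerAvg f t x) *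
        varNorm ρ (Ioi (0 : ℝ)) (fun t => centerAvg g t x)) := by
  have hρ0 : 0 < ρ := by linarith
  refine (varNorm_le_add hρ (b := fun t => centerAvg g t x) (c := fun t => centerAvg f t x)
    (varNorm ρ (Ioi (0 : ℝ)) (fun t => centerAvg f t x))
    (varNorm ρ (Ioi (0 : ℝ)) (fun t => centerAvg g t x)) fun s hs t ht => ?_).trans
    (le_of_eq (by ring))
  calc ‖Qbil f g t x - Qbil f g s x‖ₑ = ‖centerAvg f t x * (centerAvg g t x - centerAvg g s x) +
        centerAvg g s x * (centerAvg f t x - centerAvg f s x)‖ₑ := by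
        rw [Qbil_eq_mul, Qbil_eq_mul]; congr 1; ring
    _ ≤ _ := enorm_add_le _ _
    _ ≤ _ := by
        rw [enorm_mul, enorm_mul]
        gcongr
        · exact enorm_centerAvg_le_varNorm hρ0 hf ht x
        · exact enorm_centerAvg_le_varNorm hρ0 hg hs x

lemma mul_sq_volume_lt_varNorm_Qbil_le {ρ : ℝ} (hρ : 1 ≤ ρ) {f g : ℝ → ℂ} (hf : Integrable f)
    (hg : Integrable g) {F G : ℝ} (hF : ∫ x, ‖f x‖ ≤ F) (hG : ∫ x, ‖g x‖ ≤ G) (hF0 : 0 < F)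
    (hG0 : 0 < G) {l : ℝ} (hl : 0 < l) :
    ENNReal.ofReal l * volume {x : ℝ | ENNReal.ofReal l <
      varNorm ρ (Ioi (0 : ℝ)) (fun t => Qbil f g t x)} ^ 2 ≤
      8 * (64 * varConst ρ) ^ 2 * ENNReal.ofReal F * ENNReal.ofReal G := by
  set α := √(l * F / (2 * G)) with hα
  set β := √(l * G / (2 * F)) with hβ
  have hα0 : 0 < α := by positivity
  have hβ0 : 0 < β := by positivity
  have hαβ : 2 * (α * β) = l := by
    rw [hα, hβ, ← Real.sqrt_mul (by positivity),
      show l * F / (2 * G) * (l * G / (2 * F)) = (l / 2) ^ 2 by field_simp,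
      Real.sqrt_sq (by positivity)]
    ring
  have hα2 : α ^ 2 = l * F / (2 * G) := Real.sq_sqrt (by positivity)
  have hβ2 : β ^ 2 = l * G / (2 * F) := Real.sq_sqrt (by positivity)
  have hGF : G / β = F / α := by
    rw [div_eq_div_iff hβ0.ne' hα0.ne', ← sq_eq_sq₀ (by positivity) (by positivity), mul_pow,
      mul_pow, hα2, hβ2]
    field_simp
  have hsub : {x : ℝ | ENNReal.ofReal l < varNorm ρ (Ioi (0 : ℝ)) (fun t => Qbil f g t x)} ⊆
      {x | ENNReal.ofReal α < varNorm ρ (Ioi (0 : ℝ)) (fun t => centerAvg f t x)} ∪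
      {x | ENNReal.ofReal β < varNorm ρ (Ioi (0 : ℝ)) (fun t => centerAvg g t x)} := by
    intro x hx
    by_contra hcon
    simp only [mem_union, mem_ofPred_eq, not_or, not_lt] at hcon hx
    refine absurd hx (not_lt.2 ((varNorm_Qbil_le hρ hf hg x).trans ?_))
    rw [← hαβ, ENNReal.ofReal_mul (by norm_num), ENNReal.ofReal_mul hα0.le, ENNReal.ofReal_ofNat]
    gcongr
    · exact hcon.1
    · exact hcon.2
  have hvol : volume {x : ℝ | ENNReal.ofReal l <
      varNorm ρ (Ioi (0 : ℝ)) (fun t => Qbil f g t x)} ≤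
      2 * (64 * varConst ρ) * ENNReal.ofReal (F / α) := by
    refine (measure_mono hsub).trans ((measure_union_le _ _).trans
      ((add_le_add (volume_lt_varNorm_centerAvg_complex hρ hf hF α hα0)
        (volume_lt_varNorm_centerAvg_complex hρ hg hG β hβ0)).trans (le_of_eq ?_)))
    rw [hGF]
    ring
  calc _ ≤ ENNReal.ofReal l * (2 * (64 * varConst ρ) * ENNReal.ofReal (F / α)) ^ 2 := by gcongr
    _ = 4 * (64 * varConst ρ) ^ 2 * ENNReal.ofReal (l * (F / α) ^ 2) := by
        rw [ENNReal.ofReal_mul hl.le, ENNReal.ofReal_pow (by positivity)]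
        ring
    _ = 4 * (64 * varConst ρ) ^ 2 * ENNReal.ofReal (2 * F * G) := by
        congr 2
        rw [div_pow, hα2]
        field_simp
    _ = _ := by
        rw [ENNReal.ofReal_mul (by positivity), ENNReal.ofReal_mul (by norm_num),
          ENNReal.ofReal_ofNat]
        ring

/-- weak endpoint estimate `L¹ × L¹ → L^{1/2,∞}` for the ρ-variation
of bilinear averages over cubes, `ρ > 2`. -/
theorem varNorm_Qbil_weak (ρ : ℝ) (hρ : 2 < ρ) :
    ∃ C : ℝ, 0 < C ∧ ∀ f₁ f₂ : ℝ → ℂ, Integrable f₁ volume → Integrable f₂ volume →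
      ∀ l : ℝ, 0 < l →
      ENNReal.ofReal l *
          (volume {x : ℝ |
            ENNReal.ofReal l < varNorm ρ (Set.Ioi (0:ℝ)) (fun t => Qbil f₁ f₂ t x)}) ^ 2 ≤
        ENNReal.ofReal C * eLpNorm f₁ 1 volume * eLpNorm f₂ 1 volume := by
  set A : ℝ≥0∞ := 8 * (64 * varConst ρ) ^ 2 with hA
  have hAtop : A ≠ ∞ := by
    have := varConst_ne_top hρ
    finiteness
  refine ⟨A.toReal + 1, by positivity, fun f₁ f₂ h₁ h₂ l hl => ?_⟩
  have hn : ∀ f : ℝ → ℂ, Integrable f → eLpNorm f 1 volume = ENNReal.ofReal (∫ x, ‖f x‖) :=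
    fun f hf => by
      rw [eLpNorm_one_eq_lintegral_enorm, ofReal_integral_norm_eq_lintegral_enorm hf]
  rw [hn f₁ h₁, hn f₂ h₂]
  have hpos : ∀ f : ℝ → ℂ, 0 ≤ ∫ x, ‖f x‖ := fun f => integral_nonneg fun _ => norm_nonneg _
  have hle : A ≤ ENNReal.ofReal (A.toReal + 1) := by
    rw [ENNReal.le_ofReal_iff_toReal_le hAtop (by positivity)]
    linarith
  rw [← ENNReal.ofReal_mul (by positivity),
    ← ENNReal.ofReal_mul (mul_nonneg (by positivity) (hpos f₁))]
  have hc : Continuous fun η : ℝ => ENNReal.ofReal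
      ((A.toReal + 1) * ((∫ x, ‖f₁ x‖) + η) * ((∫ x, ‖f₂ x‖) + η)) :=
    ENNReal.continuous_ofReal.comp (by fun_prop)
  have hlim := (hc.tendsto 0).mono_left (nhdsWithin_le_nhds (s := Ioi 0))
  simp only [add_zero] at hlim
  refine ge_of_tendsto hlim ?_
  filter_upwards [self_mem_nhdsWithin] with η hη
  have hη : 0 < η := hη
  have h₁η : 0 < (∫ x, ‖f₁ x‖) + η := by linarith [hpos f₁]
  rw [ENNReal.ofReal_mul (by positivity), ENNReal.ofReal_mul (by positivity)]
  refine (mul_sq_volume_lt_varNorm_Qbil_le (by linarith) h₁ h₂ (F := (∫ x, ‖f₁ x‖) + η)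
    (G := (∫ x, ‖f₂ x‖) + η) (by linarith) (by linarith) h₁η
    (by linarith [hpos f₂]) hl).trans ?_
  gcongr
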